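/- For k = 1,…,r let Āₖ ∈ ℝ^{mₖ×n} and Āₖ⁺ ∈ ℝ^{n×mₖ}, and define the projectors recursively by P₀ := 1ₙ and Pₖ := P_{k−1}·(1ₙ − Āₖ⁺·Āₖ). Assume that P_{k−1}·Āₖ⁺ = Āₖ⁺ for every k = 1,…,r. Then for every k, Pₖ = 1ₙ − Σ_{i=1}^{k} Āᵢ⁺·Āᵢ; in particular, the stacked product satisfies Ā⁺·Ā = Σ_{i=1}^{r} Āᵢ⁺·Āᵢ = 1ₙ − P_r. -/

import Mathlib

open Matrix

/-- With `P₀ = 1` and `Pₖ = P_{k−1}·(1 − Āₖ⁺·Āₖ)`, the assumption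
`P_{k−1}·Āₖ⁺ = Āₖ⁺` implies `Pₖ = 1 − Σ_{i<k} Āᵢ⁺·Āᵢ` for every `k ≤ r`; in
particular, the stacked product satisfies `Σ_{i<r} Āᵢ⁺·Āᵢ = 1 − P_r`. -/
theorem projector_sum_formula {n r : ℕ} (md : ℕ → ℕ)
    (Abar : ∀ k : ℕ, Matrix (Fin (md k)) (Fin n) ℝ)
    (Abarplus : ∀ k : ℕ, Matrix (Fin n) (Fin (md k)) ℝ)
    (P : ℕ → Matrix (Fin n) (Fin n) ℝ)
    (hP0 : P 0 = 1)
    (hPrec : ∀ k, k < r → P (k + 1) = P k * (1 - Abarplus k * Abar k))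
    (hrange : ∀ k, k < r → P k * Abarplus k = Abarplus k) :
    (∀ k, k ≤ r → P k = 1 - ∑ i ∈ Finset.range k, Abarplus i * Abar i) ∧
      ∑ i ∈ Finset.range r, Abarplus i * Abar i = 1 - P r := by
  have h : ∀ k, k ≤ r → P k = 1 - ∑ i ∈ Finset.range k, Abarplus i * Abar i := by
    intro k
    induction k with
    | zero => intro _; simp [hP0]
    | succ k ih =>
      intro hk
      rw [hPrec k hk, mul_sub, mul_one, ← Matrix.mul_assoc, hrange k hk, ih (by omega),
        Finset.sum_range_succ, sub_sub]
  exact ⟨h, by rw [h r le_rfl, sub_sub_cancel]⟩
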